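/- Let $\Omega\subset\mathbb{R}^2$ be a bounded simply-connected domain with Green function $g_\Omega(\cdot,a)$ for pole $a\in\Omega$, and suppose for each $t\ge0$ the area $X(t)$ of the level set $\Omega_t=\{z\in\Omega:g_\Omega(z,a)>t\}$ satisfies $\frac{d}{dt}(e^{4\pi t}X(t))\le 0$. Then for all $0\le p_1<p_2<\infty$, $\frac{(4\pi)^{p_2}}{\Gamma(p_2+1)}\int_\Omega g_\Omega(z,a)^{p_2}dA(z)\le \frac{(4\pi)^{p_1}}{\Gamma(p_1+1)}\int_\Omega g_\Omega(z,a)^{p_1}dA(z)$. -/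

import Mathlib

open MeasureTheory Set Real

theorem mul_one_add_le_of_deriv_exp_mul_nonpos {X : ℝ → ℝ} (hX : Antitone X) {c : ℝ} (hc : 0 < c)
    (hd : ∀ t ≥ (0 : ℝ), deriv (fun s => exp (c * s) * X s) t ≤ 0)
    {a b : ℝ} (ha : 0 ≤ a) (hab : a ≤ b) :
    X b * (1 + c * (b - a)) ≤ X a := by
  have hmono : Monotone (-X) := hX.neg
  have hle := (hmono.monotoneOn (uIcc a b)).intervalIntegral_deriv_mem_uIcc
  have hint := (hmono.monotoneOn (uIcc a b)).intervalIntegrable_deriv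
  rw [uIcc_of_le (sub_nonneg.2 (hmono hab))] at hle
  have key : ∫ x in a..b, c * X b ≤ ∫ x in a..b, deriv (-X) x := by
    refine intervalIntegral.integral_mono_ae_restrict hab (by simp) hint ?_
    filter_upwards [ae_restrict_of_ae hmono.ae_differentiableAt,
      ae_restrict_mem measurableSet_Icc] with x hx hxI
    have hXd : HasDerivAt X (deriv X x) x := by
      have := hx.neg
      rw [neg_neg] at this
      exact this.hasDerivAt
    have hexp : HasDerivAt (fun s => exp (c * s)) (exp (c * x) * (c * 1)) x :=
      ((hasDerivAt_id x).const_mul c).exp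
    have h := hd x (ha.trans hxI.1)
    rw [(hexp.fun_mul hXd).deriv] at h
    have h2 : c * X x + deriv X x ≤ 0 := by
      have : exp (c * x) * (c * X x + deriv X x) ≤ 0 := by linarith
      exact nonpos_of_mul_nonpos_right this (exp_pos _)
    have h3 : c * X b ≤ c * X x := mul_le_mul_of_nonneg_left (hX hxI.2) hc.le
    rw [hXd.neg.deriv]
    linarith
  rw [intervalIntegral.integral_const, smul_eq_mul] at key
  have := hle.2
  simp only [Pi.neg_apply] at this
  linarith

/-- An antitone function `X` need not be absolutely continuous, but its jumps and its singular part
only help, so the pointwise differential inequality can be integrated. -/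
theorem antitoneOn_exp_mul_of_deriv_nonpos {X : ℝ → ℝ} (hX : Antitone X) {c : ℝ} (hc : 0 < c)
    (hd : ∀ t ≥ (0 : ℝ), deriv (fun s => exp (c * s) * X s) t ≤ 0) :
    AntitoneOn (fun s => exp (c * s) * X s) (Ici 0) := by
  intro a ha b hb hab
  have ha : 0 ≤ a := ha
  have hstep (n : ℕ) : X b * (1 + c * (b - a) / n) ^ n ≤ X a := by
    rcases Nat.eq_zero_or_pos n with rfl | hn
    · simpa using hX hab
    have hn' : (0 : ℝ) < n := Nat.cast_pos.2 hn
    set δ := (b - a) / n with hδ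
    have hδ0 : 0 ≤ δ := div_nonneg (sub_nonneg.2 hab) hn'.le
    have hq : 1 + c * (b - a) / n = 1 + c * δ := by rw [hδ]; ring
    have hq0 : 0 ≤ 1 + c * δ := by positivity
    have hind (k : ℕ) : X (a + k * δ) * (1 + c * δ) ^ k ≤ X a := by
      induction k with
      | zero => simp
      | succ k ih =>
        have h := mul_one_add_le_of_deriv_exp_mul_nonpos hX hc hd
          (a := a + k * δ) (b := a + (k + 1 : ℕ) * δ) (by positivity) (by push_cast; linarith)
        rw [show a + ((k + 1 : ℕ) : ℝ) * δ - (a + k * δ) = δ by push_cast; ring] at h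
        calc X (a + (k + 1 : ℕ) * δ) * (1 + c * δ) ^ (k + 1)
            = X (a + (k + 1 : ℕ) * δ) * (1 + c * δ) * (1 + c * δ) ^ k := by ring
          _ ≤ X (a + k * δ) * (1 + c * δ) ^ k := mul_le_mul_of_nonneg_right h (by positivity)
          _ ≤ X a := ih
    have h := hind n
    rwa [hδ, mul_div_cancel₀ _ hn'.ne', ← hδ, add_sub_cancel, ← hq] at h
  have hlim := le_of_tendsto' ((tendsto_one_add_div_pow_exp (c * (b - a))).const_mul (X b)) hstep
  calc exp (c * b) * X b = exp (c * a) * (X b * exp (c * (b - a))) := by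
        rw [show c * b = c * a + c * (b - a) by ring, exp_add]; ring
    _ ≤ exp (c * a) * X a := mul_le_mul_of_nonneg_left hlim (exp_pos _).le

theorem integrableOn_rpow_mul_exp_neg_mul {c p : ℝ} (hc : 0 < c) (hp : 0 < p) :
    IntegrableOn (fun t : ℝ => t ^ (p - 1) * exp (-(c * t))) (Ioi 0) := by
  simpa using integrableOn_rpow_mul_exp_neg_mul_rpow (p := 1) (s := p - 1) (b := c)
    (by linarith) one_pos hc

theorem integral_gamma_density {c p : ℝ} (hc : 0 < c) (hp : 0 < p) :
    ∫ t in Ioi (0 : ℝ), c ^ p / Gamma p * (t ^ (p - 1) * exp (-(c * t))) = 1 := by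
  rw [integral_const_mul, integral_rpow_mul_exp_neg_mul_Ioi hp hc, div_rpow zero_le_one hc.le,
    one_rpow]
  have := (Gamma_pos_of_pos hp).ne'
  have := (rpow_pos_of_pos hc p).ne'
  field_simp

section GammaExpectation

variable {F : ℝ → ℝ} {c : ℝ}

theorem integrableOn_gamma_density_mul (hF : AntitoneOn F (Ici 0)) (hF0 : ∀ t, 0 ≤ F t)
    (hc : 0 < c) {p : ℝ} (hp : 0 < p) :
    IntegrableOn (fun t => c ^ p / Gamma p * (t ^ (p - 1) * exp (-(c * t))) * F t) (Ioi 0) := by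
  refine Integrable.mul_bdd (c := F 0) ((integrableOn_rpow_mul_exp_neg_mul hc hp).const_mul _)
    (aemeasurable_restrict_of_antitoneOn measurableSet_Ioi
      (hF.mono Ioi_subset_Ici_self)).aestronglyMeasurable ?_
  filter_upwards [ae_restrict_mem measurableSet_Ioi] with t ht
  have ht : 0 < t := ht
  rw [norm_of_nonneg (hF0 t)]
  exact hF self_mem_Ici ht.le ht.le

/-- Gamma distributions with a fixed rate are stochastically increasing in the shape. -/
theorem integral_gamma_density_mul_anti (hF : AntitoneOn F (Ici 0)) (hF0 : ∀ t, 0 ≤ F t)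
    (hc : 0 < c) {p q : ℝ} (hp : 0 < p) (hpq : p < q) :
    ∫ t in Ioi (0 : ℝ), c ^ q / Gamma q * (t ^ (q - 1) * exp (-(c * t))) * F t ≤
      ∫ t in Ioi (0 : ℝ), c ^ p / Gamma p * (t ^ (p - 1) * exp (-(c * t))) * F t := by
  have hq := hp.trans hpq
  have hip := (integrableOn_rpow_mul_exp_neg_mul hc hp).const_mul (c ^ p / Gamma p)
  have hiq := (integrableOn_rpow_mul_exp_neg_mul hc hq).const_mul (c ^ q / Gamma q)
  have hFp := integrableOn_gamma_density_mul hF hF0 hc hp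
  have hFq := integrableOn_gamma_density_mul hF hF0 hc hq
  have hp1 := integral_gamma_density hc hp
  have hq1 := integral_gamma_density hc hq
  have hkp : 0 < c ^ p / Gamma p := div_pos (rpow_pos_of_pos hc p) (Gamma_pos_of_pos hp)
  have hkq : 0 < c ^ q / Gamma q := div_pos (rpow_pos_of_pos hc q) (Gamma_pos_of_pos hq)
  set k := c ^ p / Gamma p
  set l := c ^ q / Gamma q
  have hr : 0 < q - p := sub_pos.2 hpq
  -- the point where the two densities cross
  set x := (k / l) ^ (q - p)⁻¹ with hx
  have hx0 : 0 < x := by positivity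
  have hxr : l * x ^ (q - p) = k := by
    rw [hx, rpow_inv_rpow (by positivity) hr.ne']
    field_simp
  have hcmp : ∀ t ∈ Ioi (0 : ℝ), l * (t ^ (q - 1) * exp (-(c * t))) * F t +
      k * (t ^ (p - 1) * exp (-(c * t))) * F x ≤
      k * (t ^ (p - 1) * exp (-(c * t))) * F t + l * (t ^ (q - 1) * exp (-(c * t))) * F x := by
    intro t ht
    have ht : 0 < t := ht
    have hsplit : t ^ (q - 1) = t ^ (p - 1) * t ^ (q - p) := by
      rw [← rpow_add ht]; congr 1; ring
    have hprod : (l * t ^ (q - p) - k) * (F t - F x) ≤ 0 := by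
      rcases le_total t x with h | h
      · refine mul_nonpos_of_nonpos_of_nonneg ?_ (sub_nonneg.2 (hF ht.le hx0.le h))
        have := mul_le_mul_of_nonneg_left (rpow_le_rpow ht.le h hr.le) hkq.le
        linarith
      · refine mul_nonpos_of_nonneg_of_nonpos ?_ (sub_nonpos.2 (hF hx0.le ht.le h))
        have := mul_le_mul_of_nonneg_left (rpow_le_rpow hx0.le h hr.le) hkq.le
        linarith
    have := mul_nonpos_of_nonneg_of_nonpos
      (mul_pos (rpow_pos_of_pos ht (p - 1)) (exp_pos (-(c * t)))).le hprod
    rw [hsplit]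
    linarith
  have h := setIntegral_mono_on (hFq.add (hip.mul_const (F x))) (hFp.add (hiq.mul_const (F x)))
    measurableSet_Ioi hcmp
  simp only [Pi.add_apply] at h
  rw [integral_add hFq (hip.mul_const _), integral_add hFp (hiq.mul_const _),
    integral_mul_const, integral_mul_const, hp1, hq1] at h
  linarith

theorem integral_gamma_density_mul_le (hF : AntitoneOn F (Ici 0)) (hF0 : ∀ t, 0 ≤ F t)
    (hc : 0 < c) {p : ℝ} (hp : 0 < p) :
    ∫ t in Ioi (0 : ℝ), c ^ p / Gamma p * (t ^ (p - 1) * exp (-(c * t))) * F t ≤ F 0 := by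
  have h := setIntegral_mono_on (integrableOn_gamma_density_mul hF hF0 hc hp)
    (((integrableOn_rpow_mul_exp_neg_mul hc hp).const_mul (c ^ p / Gamma p)).mul_const (F 0))
    measurableSet_Ioi fun t (ht : 0 < t) =>
      mul_le_mul_of_nonneg_left (hF self_mem_Ici ht.le ht.le) (by
        have := Gamma_pos_of_pos hp
        positivity)
  rwa [integral_mul_const, integral_gamma_density hc hp, one_mul] at h

end GammaExpectation

/-- The layer-cake formula for `∫ f ^ p`, with the tail `μ {f > t}` tilted by `exp (c * t)`. -/
theorem integral_rpow_eq_integral_gamma_density_mul {α : Type*} [MeasurableSpace α] {μ : Measure α}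
    [IsFiniteMeasure μ] {f : α → ℝ} (hf : 0 ≤ᵐ[μ] f) (hfm : AEMeasurable f μ) {c p : ℝ}
    (hp : 0 < p) :
    c ^ p / Gamma (p + 1) * ∫ x, f x ^ p ∂μ =
      ∫ t in Ioi (0 : ℝ), c ^ p / Gamma p * (t ^ (p - 1) * exp (-(c * t))) *
        (exp (c * t) * μ.real {x | t < f x}) := by
  have hmeas : Measurable fun t : ℝ => μ.real {x | t < f x} :=
    Antitone.measurable fun s t hst => measureReal_mono fun x (hx : t < f x) => hst.trans_lt hx
  have hlayer : ∫ x, f x ^ p ∂μ = p * ∫ t in Ioi (0 : ℝ), t ^ (p - 1) * μ.real {x | t < f x} := by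
    rw [integral_eq_lintegral_of_nonneg_ae (hf.mono fun x hx => rpow_nonneg hx p)
        (hfm.pow_const p).aestronglyMeasurable,
      lintegral_rpow_eq_lintegral_meas_lt_mul μ hf hfm hp, ENNReal.toReal_mul,
      ENNReal.toReal_ofReal hp.le, integral_eq_lintegral_of_nonneg_ae]
    · congr 2
      refine setLIntegral_congr_fun measurableSet_Ioi fun t (ht : 0 < t) => ?_
      rw [ENNReal.ofReal_mul (rpow_nonneg ht.le _), ofReal_measureReal, mul_comm]
    · filter_upwards [ae_restrict_mem measurableSet_Ioi] with t ht
      have ht : 0 < t := ht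
      positivity
    · exact ((measurable_id.pow_const (p - 1)).mul hmeas).aestronglyMeasurable
  rw [hlayer, Gamma_add_one hp.ne', ← mul_assoc, ← integral_const_mul]
  refine setIntegral_congr_fun measurableSet_Ioi fun t _ => ?_
  have h1 : exp (-(c * t)) * exp (c * t) = 1 := by rw [← exp_add]; simp
  have := (Gamma_pos_of_pos hp).ne'
  calc c ^ p / (p * Gamma p) * p * (t ^ (p - 1) * μ.real {x | t < f x})
      = c ^ p / Gamma p * (t ^ (p - 1) * μ.real {x | t < f x}) := by field_simp
    _ = c ^ p / Gamma p * (t ^ (p - 1) * μ.real {x | t < f x}) *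
        (exp (-(c * t)) * exp (c * t)) := by rw [h1, mul_one]
    _ = _ := by ring

/-- Monotonicity of `L^p` integrals of the Green function of a bounded simply-connected
planar domain: if the area `X(t)` of the superlevel set `{g_Ω(·,a) > t}` satisfies
`(e^{4πt} X(t))' ≤ 0`, then `p ↦ (4π)^p/Γ(p+1) ∫_Ω g^p dA` is nonincreasing. -/
theorem stmt10 (Ω : Set ℂ) (hΩo : IsOpen Ω) (hΩb : Bornology.IsBounded Ω)
    (hΩsc : SimplyConnectedSpace Ω) (a : ℂ) (ha : a ∈ Ω)
    (g : ℂ → ℝ) (hg : ∀ z ∈ Ω, 0 ≤ g z)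
    (X : ℝ → ℝ) (hX : ∀ t, X t = (volume {z ∈ Ω | t < g z}).toReal)
    (hd : ∀ t ≥ (0 : ℝ), deriv (fun s => Real.exp (4 * π * s) * X s) t ≤ 0)
    (p₁ p₂ : ℝ) (hp₁ : 0 ≤ p₁) (hp₁₂ : p₁ < p₂) :
    (4 * π) ^ p₂ / Real.Gamma (p₂ + 1) * ∫ z in Ω, g z ^ p₂ ≤
      (4 * π) ^ p₁ / Real.Gamma (p₁ + 1) * ∫ z in Ω, g z ^ p₁ := by
  have hc : 0 < 4 * π := by positivity
  have hp₂ : 0 < p₂ := hp₁.trans_lt hp₁₂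
  have hg_ae : 0 ≤ᵐ[volume.restrict Ω] g := by
    filter_upwards [ae_restrict_mem hΩo.measurableSet] with z hz using hg z hz
  have hrhs : 0 ≤ (4 * π) ^ p₁ / Gamma (p₁ + 1) * ∫ z in Ω, g z ^ p₁ :=
    mul_nonneg (div_nonneg (by positivity) (Gamma_nonneg_of_nonneg (by linarith)))
      (integral_nonneg_of_ae (hg_ae.mono fun z hz => rpow_nonneg hz p₁))
  by_cases hgm : AEMeasurable g (volume.restrict Ω)
  swap
  · have hnot : ¬ Integrable (fun z => g z ^ p₂) (volume.restrict Ω) := fun h =>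
      hgm <| (h.aemeasurable.pow_const p₂⁻¹).congr <|
        hg_ae.mono fun z hz => rpow_rpow_inv hz hp₂.ne'
    rwa [integral_undef hnot, mul_zero]
  have hΩfin : volume Ω < ⊤ := hΩb.measure_lt_top
  have : IsFiniteMeasure (volume.restrict Ω) := ⟨by simpa using hΩfin⟩
  have hXr (t : ℝ) : X t = (volume.restrict Ω).real {z | t < g z} := by
    rw [hX, measureReal_def, Measure.restrict_apply' hΩo.measurableSet, inter_comm]
    rfl
  have hXanti : Antitone X := fun s t hst => by
    rw [hXr, hXr]
    exact measureReal_mono fun z (hz : t < g z) => hst.trans_lt hz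
  have hF := antitoneOn_exp_mul_of_deriv_nonpos hXanti hc hd
  have hF0 (t : ℝ) : 0 ≤ exp (4 * π * t) * X t := by
    rw [hXr]
    positivity
  rw [integral_rpow_eq_integral_gamma_density_mul hg_ae hgm hp₂]
  simp_rw [← hXr]
  rcases hp₁.eq_or_lt with rfl | hp₁pos
  · refine (integral_gamma_density_mul_le hF hF0 hc hp₂).trans ?_
    simp only [mul_zero, exp_zero, one_mul, rpow_zero, zero_add, Gamma_one, div_one,
      integral_const, smul_eq_mul, mul_one, hXr]
    exact measureReal_mono (subset_univ _)
  · rw [integral_rpow_eq_integral_gamma_density_mul hg_ae hgm hp₁pos]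
    simp_rw [← hXr]
    exact integral_gamma_density_mul_anti hF hF0 hc hp₁pos hp₁₂
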